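/- cof(M_{κ^ω}) ≤ cof(NWD_{κ^ω}): the cofinality of the ideal of meager subsets of κ^ω is at most the cofinality of the ideal of nowhere dense subsets of κ^ω. -/

import Mathlib

def consK {K : Type*} (a : K) (x : ℕ → K) : ℕ → K := fun n => Nat.casesOn n a x

def tailK {K : Type*} (y : ℕ → K) : ℕ → K := fun n => y (n + 1)

theorem tail_consK {K : Type*} (a : K) (x : ℕ → K) : tailK (consK a x) = x := rfl

theorem cons_tailK {K : Type*} (y : ℕ → K) : consK (y 0) (tailK y) = y := by
  funext n; cases n <;> rfl

theorem continuous_tailK {K : Type*} [TopologicalSpace K] :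
    Continuous (tailK : (ℕ → K) → (ℕ → K)) :=
  continuous_pi fun n => continuous_apply (n + 1)

theorem continuous_consK {K : Type*} [TopologicalSpace K] (a : K) :
    Continuous (consK a : (ℕ → K) → (ℕ → K)) := by
  refine continuous_pi fun n => ?_
  cases n with
  | zero => exact continuous_const
  | succ n => exact continuous_apply n

theorem isOpen_cylK {K : Type*} [TopologicalSpace K] [DiscreteTopology K] (a : K) :
    IsOpen {y : ℕ → K | y 0 = a} :=
  (isOpen_discrete ({a} : Set K)).preimage (continuous_apply (A := fun _ : ℕ => K) 0)

theorem nwd_preimage_consK {K : Type*} [TopologicalSpace K] [DiscreteTopology K] (a : K)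
    {t : Set (ℕ → K)} (ht : IsNowhereDense t) : IsNowhereDense (consK a ⁻¹' t) := by
  unfold IsNowhereDense at *
  rw [Set.eq_empty_iff_forall_notMem]
  intro x hx
  have hW : IsOpen ({y : ℕ → K | y 0 = a} ∩ tailK ⁻¹' (interior (closure (consK a ⁻¹' t)))) :=
    (isOpen_cylK a).inter (isOpen_interior.preimage continuous_tailK)
  have hsub : ({y : ℕ → K | y 0 = a} ∩ tailK ⁻¹' (interior (closure (consK a ⁻¹' t))))
      ⊆ closure t := by
    rintro y ⟨rfl, hy⟩
    have := (continuous_consK (y 0)).closure_preimage_subset t (interior_subset hy)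
    rwa [Set.mem_preimage, cons_tailK] at this
  have : consK a x ∈ interior (closure t) :=
    interior_maximal hsub hW ⟨rfl, hx⟩
  rw [ht] at this
  exact this

theorem nwd_codeK {K : Type*} [TopologicalSpace K] [DiscreteTopology K] (e : ℕ ↪ K)
    (N : ℕ → Set (ℕ → K)) (hN : ∀ n, IsNowhereDense (N n)) :
    IsNowhereDense (⋃ n, consK (e n) '' N n) := by
  have hc : ∀ n, IsNowhereDense (consK (e n) '' N n) := fun n =>
    Topology.IsInducing.isNowhereDense_image
      (Topology.IsEmbedding.of_leftInverse (tail_consK (e n)) continuous_tailK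
        (continuous_consK (e n))).isInducing (hN n)
  rw [IsNowhereDense, Set.eq_empty_iff_forall_notMem]
  intro z hz
  obtain ⟨y, hyv, hyu⟩ := mem_closure_iff.1 (interior_subset hz) _ isOpen_interior hz
  obtain ⟨n, x, hx, rfl⟩ := Set.mem_iUnion.1 hyu
  set u := ⋃ n, consK (e n) '' N n with hu
  have hW : IsOpen ({y : ℕ → K | y 0 = e n} ∩ interior (closure u)) :=
    (isOpen_cylK _).inter isOpen_interior
  have hsub : ({y : ℕ → K | y 0 = e n} ∩ interior (closure u))
      ⊆ closure (consK (e n) '' N n) := by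
    rintro w ⟨hw0, hw⟩
    have h1 := (isOpen_cylK (e n)).inter_closure ⟨hw0, interior_subset hw⟩
    refine closure_mono ?_ h1
    rintro p ⟨hp0, hp⟩
    obtain ⟨m, q, hq, rfl⟩ := Set.mem_iUnion.1 hp
    have : m = n := e.injective hp0
    subst this
    exact ⟨q, hq, rfl⟩
  have := interior_maximal hsub hW ⟨rfl, hyv⟩
  rw [hc n] at this
  exact this

/-- The cofinality of the meager ideal of `K^ω` is at most the cofinality of the
ideal of nowhere dense subsets of `K^ω`. -/
theorem stmt_16 {K : Type*} [TopologicalSpace K] [DiscreteTopology K] [Infinite K] :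
    sInf {c : Cardinal | ∃ F : Set (Set (ℕ → K)), (∀ s ∈ F, IsMeagre s) ∧
        (∀ s : Set (ℕ → K), IsMeagre s → ∃ t ∈ F, s ⊆ t) ∧ Cardinal.mk F = c}
      ≤ sInf {c : Cardinal | ∃ F : Set (Set (ℕ → K)), (∀ s ∈ F, IsNowhereDense s) ∧
        (∀ s : Set (ℕ → K), IsNowhereDense s → ∃ t ∈ F, s ⊆ t) ∧ Cardinal.mk F = c} := by
  have hne : {c : Cardinal | ∃ F : Set (Set (ℕ → K)), (∀ s ∈ F, IsNowhereDense s) ∧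
      (∀ s : Set (ℕ → K), IsNowhereDense s → ∃ t ∈ F, s ⊆ t) ∧ Cardinal.mk F = c}.Nonempty :=
    ⟨_, {s | IsNowhereDense s}, fun s hs => hs, fun s hs => ⟨s, hs, subset_rfl⟩, rfl⟩
  refine le_csInf hne ?_
  rintro c ⟨F, hF, hcof, rfl⟩
  let e : ℕ ↪ K := Infinite.natEmbedding K
  let Φ : Set (ℕ → K) → Set (ℕ → K) := fun t => ⋃ n, consK (e n) ⁻¹' t
  refine le_trans (b := Cardinal.mk (Φ '' F)) ?_ Cardinal.mk_image_le
  refine csInf_le' ?_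
  refine ⟨Φ '' F, ?_, ?_, rfl⟩
  · rintro _ ⟨t, ht, rfl⟩
    exact isMeagre_iUnion fun n => (nwd_preimage_consK (e n) (hF t ht)).isMeagre
  · intro s hs
    obtain ⟨S, hS, hSc, hsS⟩ := isMeagre_iff_countable_union_isNowhereDense.1 hs
    obtain ⟨N, hN⟩ := (hSc.insert ∅).exists_eq_range (Set.insert_nonempty _ _)
    have hNn : ∀ n, IsNowhereDense (N n) := by
      intro n
      have : N n ∈ insert ∅ S := hN ▸ Set.mem_range_self n
      rcases this with h | h
      · rw [h]; exact isNowhereDense_empty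
      · exact hS _ h
    obtain ⟨t, htF, hut⟩ := hcof _ (nwd_codeK e N hNn)
    refine ⟨Φ t, ⟨t, htF, rfl⟩, ?_⟩
    intro x hx
    obtain ⟨A, hA, hxA⟩ := hsS hx
    have hA2 : A ∈ Set.range N := hN ▸ Set.mem_insert_of_mem _ hA
    obtain ⟨n, rfl⟩ := hA2
    exact Set.mem_iUnion.2 ⟨n, hut (Set.mem_iUnion.2 ⟨n, x, hxA, rfl⟩)⟩
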